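/- As n → ∞, the logarithm of the number of finitely supported functions ν : X → ℕ with endpoint (n,n) satisfies ln(card Π_n) = 3·(ζ(3)/ζ(2))^{1/3}·n^{2/3}·(1 + o(1)), where ζ(2) = π²/6 and ζ(3) = ∑_{k≥1} 1/k³. -/

import Mathlib

open Real Filter Asymptotics

/-- The set of pairs of coprime nonnegative integers (including `(0,1)` and `(1,0)`). -/
abbrev Xc : Type := {x : ℕ × ℕ // Nat.gcd x.1 x.2 = 1}

/-- The endpoint of the convex chain encoded by a finitely supported `ν : X →₀ ℕ`. -/
def chainEndpoint (ν : Xc →₀ ℕ) : ℕ × ℕ :=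
  (ν.sum fun x m => m * x.val.1, ν.sum fun x m => m * x.val.2)

noncomputable def zeta2 : ℝ := π ^ 2 / 6

noncomputable def zeta3 : ℝ := ∑' k : ℕ, 1 / ((k : ℝ) + 1) ^ 3


/-! ### Generating functions of finitely supported multiplicities -/

section GeneratingFunction

variable {ι : Type*} {q : ι → ℝ}

lemma sum_finsupp_range_prod_pow (q : ι → ℝ) (F : Finset ι) (N : ℕ) :
    ∑ ν ∈ F.finsupp (fun _ => Finset.range N), ν.prod (fun x m => q x ^ m)
      = ∏ x ∈ F, ∑ m ∈ Finset.range N, q x ^ m := by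
  classical
  rw [Finset.prod_sum, Finset.finsupp, Finset.sum_map]
  refine Finset.sum_congr rfl fun p _ => ?_
  change (Finsupp.indicator F p).prod (fun x m => q x ^ m) = _
  rw [Finsupp.prod_of_support_subset _ (Finsupp.support_indicator_subset F _) _ (by simp)]
  rw [← Finset.prod_attach]
  refine Finset.prod_congr rfl fun x _ => ?_
  simp [Finsupp.indicator_of_mem x.2]

lemma finsupp_prod_pow_nonneg (hq0 : ∀ x, 0 ≤ q x) (ν : ι →₀ ℕ) :
    0 ≤ ν.prod fun x m => q x ^ m :=
  Finset.prod_nonneg fun x _ => pow_nonneg (hq0 x) _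

/-- Euler's product formula for finitely supported multiplicities, in logarithmic form. -/
lemma hasSum_finsupp_prod_pow (hq0 : ∀ x, 0 ≤ q x) (hq1 : ∀ x, q x < 1)
    (hs : Summable fun x => -Real.log (1 - q x)) :
    HasSum (fun ν : ι →₀ ℕ => ν.prod fun x m => q x ^ m)
      (Real.exp (∑' x, -Real.log (1 - q x))) := by
  classical
  have hpos : ∀ x, 0 < 1 - q x := fun x => sub_pos.2 (hq1 x)
  have hlog : ∀ x, 0 ≤ -Real.log (1 - q x) := fun x =>
    neg_nonneg.2 (Real.log_nonpos (hpos x).le (by linarith [hq0 x]))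
  have hprod : ∀ F : Finset ι,
      ∏ x ∈ F, (1 - q x)⁻¹ = Real.exp (∑ x ∈ F, -Real.log (1 - q x)) := fun F => by
    rw [Real.exp_sum]
    refine Finset.prod_congr rfl fun x _ => ?_
    rw [Real.exp_neg, Real.exp_log (hpos x)]
  have hgeom : ∀ x, HasSum (fun m : ℕ => q x ^ m) (1 - q x)⁻¹ := fun x =>
    hasSum_geometric_of_lt_one (hq0 x) (hq1 x)
  have hnn := finsupp_prod_pow_nonneg hq0
  have hupper : ∀ S : Finset (ι →₀ ℕ), ∑ ν ∈ S, (ν.prod fun x m => q x ^ m)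
      ≤ Real.exp (∑' x, -Real.log (1 - q x)) := fun S => by
    set F : Finset ι := S.biUnion fun ν => ν.support
    set N : ℕ := (∑ ν ∈ S, ∑ x ∈ F, ν x) + 1 with hN
    have hsub : S ⊆ F.finsupp (fun _ => Finset.range N) := fun ν hν => by
      rw [Finset.mem_finsupp_iff]
      refine ⟨Finset.subset_biUnion_of_mem (fun ν : ι →₀ ℕ => ν.support) hν, fun x hx => ?_⟩
      rw [Finset.mem_range, hN, Nat.lt_succ_iff]
      exact (Finset.single_le_sum (f := fun x => ν x) (fun _ _ => Nat.zero_le _) hx).trans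
        (Finset.single_le_sum (f := fun ν : ι →₀ ℕ => ∑ x ∈ F, ν x)
          (fun _ _ => Nat.zero_le _) hν)
    calc ∑ ν ∈ S, (ν.prod fun x m => q x ^ m)
        ≤ ∑ ν ∈ F.finsupp (fun _ => Finset.range N), ν.prod (fun x m => q x ^ m) :=
          Finset.sum_le_sum_of_subset_of_nonneg hsub fun ν _ _ => hnn ν
      _ = ∏ x ∈ F, ∑ m ∈ Finset.range N, q x ^ m := sum_finsupp_range_prod_pow q F N
      _ ≤ ∏ x ∈ F, (1 - q x)⁻¹ := Finset.prod_le_prod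
          (fun x _ => Finset.sum_nonneg fun m _ => pow_nonneg (hq0 x) m)
          (fun x _ => sum_le_hasSum _ (fun m _ => pow_nonneg (hq0 x) m) (hgeom x))
      _ = Real.exp (∑ x ∈ F, -Real.log (1 - q x)) := hprod F
      _ ≤ _ := Real.exp_le_exp.2 (hs.sum_le_tsum F fun x _ => hlog x)
  have hsum : Summable (fun ν : ι →₀ ℕ => ν.prod fun x m => q x ^ m) :=
    summable_of_sum_le hnn hupper
  have hle := hsum.tsum_le_of_sum_le hupper
  have hge : ∀ F : Finset ι, Real.exp (∑ x ∈ F, -Real.log (1 - q x))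
      ≤ ∑' ν : ι →₀ ℕ, ν.prod fun x m => q x ^ m := fun F => by
    rw [← hprod]
    refine le_of_tendsto (tendsto_finsetProd F fun x _ => (hgeom x).tendsto_sum_nat)
      (Filter.Eventually.of_forall fun N => ?_)
    rw [← sum_finsupp_range_prod_pow]
    exact hsum.sum_le_tsum _ fun ν _ => hnn ν
  have hge' : Real.exp (∑' x, -Real.log (1 - q x))
      ≤ ∑' ν : ι →₀ ℕ, ν.prod fun x m => q x ^ m :=
    le_of_tendsto ((Real.continuous_exp.tendsto _).comp hs.hasSum) (Filter.Eventually.of_forall hge)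
  rw [le_antisymm hge' hle]
  exact hsum.hasSum

end GeneratingFunction

/-! ### Möbius inversion for series -/

lemma tsum_moebius_mul_tsum {f : ℕ → ℝ}
    (hf : Summable fun p : ℕ+ × ℕ+ => f ((p.1 : ℕ) * p.2)) :
    ∑' d : ℕ+, (ArithmeticFunction.moebius (d : ℕ) : ℝ) * ∑' e : ℕ+, f ((d : ℕ) * e) = f 1 := by
  have hμ : ∀ n : ℕ, |(ArithmeticFunction.moebius n : ℝ)| ≤ 1 := fun n => by
    exact_mod_cast ArithmeticFunction.abs_moebius_le_one
  have hs : Summable fun p : ℕ+ × ℕ+ =>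
      (ArithmeticFunction.moebius (p.1 : ℕ) : ℝ) * f ((p.1 : ℕ) * p.2) := by
    refine Summable.of_norm_bounded hf.abs fun p => ?_
    rw [Real.norm_eq_abs, abs_mul]
    exact mul_le_of_le_one_left (abs_nonneg _) (hμ _)
  have h1 : ∑' d : ℕ+, (ArithmeticFunction.moebius (d : ℕ) : ℝ) * ∑' e : ℕ+, f ((d : ℕ) * e)
      = ∑' p : ℕ+ × ℕ+, (ArithmeticFunction.moebius (p.1 : ℕ) : ℝ) * f ((p.1 : ℕ) * p.2) := by
    rw [hs.tsum_prod]
    simp_rw [tsum_mul_left]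
  have hinner : ∀ n : ℕ+, ∑' c : Nat.divisorsAntidiagonal n,
      (ArithmeticFunction.moebius c.1.1 : ℝ) * f (c.1.1 * c.1.2) = if n = 1 then f 1 else 0 := by
    intro n
    have hz : ∑ d ∈ (n : ℕ).divisors, (ArithmeticFunction.moebius d : ℝ)
        = if n = 1 then 1 else 0 := by
      have h := congrArg (fun g : ArithmeticFunction ℤ => g n)
        ArithmeticFunction.moebius_mul_coe_zeta
      simp only [ArithmeticFunction.coe_mul_zeta_apply, ArithmeticFunction.one_apply,
        PNat.coe_eq_one_iff] at h
      exact_mod_cast h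
    rw [tsum_fintype, Finset.sum_coe_sort (Nat.divisorsAntidiagonal n)
      (fun c : ℕ × ℕ => (ArithmeticFunction.moebius c.1 : ℝ) * f (c.1 * c.2))]
    rw [Finset.sum_congr rfl (g := fun c => (ArithmeticFunction.moebius c.1 : ℝ) * f n)
      (fun c hc => by rw [(Nat.mem_divisorsAntidiagonal.1 hc).1]), ← Finset.sum_mul,
      Nat.sum_divisorsAntidiagonal (fun d _ => (ArithmeticFunction.moebius d : ℝ)), hz]
    split_ifs with h <;> simp [h]
  have hs' := (sigmaAntidiagonalEquivProd.summable_iff).2 hs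
  calc _ = _ := h1
    _ = _ := (sigmaAntidiagonalEquivProd.tsum_eq _).symm
    _ = _ := hs'.tsum_sigma
    _ = ∑' n : ℕ+, if n = 1 then f 1 else 0 := tsum_congr hinner
    _ = f 1 := tsum_ite_eq 1 _

lemma summable_pnat_one_div_sq : Summable fun n : ℕ+ => 1 / (n : ℝ) ^ 2 :=
  (summable_pnat_iff_summable_nat (f := fun n : ℕ => 1 / (n : ℝ) ^ 2)).2 hasSum_zeta_two.summable

lemma tsum_pnat_one_div_sq : ∑' n : ℕ+, 1 / (n : ℝ) ^ 2 = zeta2 := by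
  rw [tsum_pnat_eq_tsum_of_eq_zero (f := fun n : ℕ => 1 / (n : ℝ) ^ 2) (by simp),
    hasSum_zeta_two.tsum_eq, zeta2]

lemma zeta2_pos : 0 < zeta2 := by unfold zeta2; positivity

lemma summable_prod_one_div_sq :
    Summable fun p : ℕ+ × ℕ+ => 1 / (p.1 : ℝ) ^ 2 * (1 / (p.2 : ℝ) ^ 2) :=
  summable_pnat_one_div_sq.mul_of_nonneg summable_pnat_one_div_sq
    (fun _ => by positivity) (fun _ => by positivity)

lemma tsum_moebius_div_sq :
    ∑' d : ℕ+, (ArithmeticFunction.moebius (d : ℕ) : ℝ) * (1 / (d : ℝ) ^ 2) = 1 / zeta2 := by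
  have h := tsum_moebius_mul_tsum (f := fun n : ℕ => 1 / (n : ℝ) ^ 2) (by
    refine summable_prod_one_div_sq.congr fun p => ?_
    push_cast
    ring)
  have h' : ∀ d : ℕ+, ∑' e : ℕ+, 1 / (((d : ℕ) * e : ℕ) : ℝ) ^ 2 = 1 / (d : ℝ) ^ 2 * zeta2 :=
    fun d => by
      rw [← tsum_pnat_one_div_sq, ← tsum_mul_left]
      refine tsum_congr fun e => ?_
      push_cast
      ring
  simp_rw [h', ← mul_assoc, tsum_mul_right] at h
  rw [eq_div_iff zeta2_pos.ne', h]
  simp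

lemma tsum_pnat_one_div_cube : ∑' n : ℕ+, 1 / (n : ℝ) ^ 3 = zeta3 := by
  rw [tsum_pnat_eq_tsum_succ (f := fun n : ℕ => 1 / (n : ℝ) ^ 3), zeta3]
  simp

lemma zeta3_pos : 0 < zeta3 := by
  have hs : Summable fun n : ℕ+ => 1 / (n : ℝ) ^ 3 :=
    (summable_pnat_iff_summable_nat (f := fun n : ℕ => 1 / (n : ℝ) ^ 3)).2
      (Real.summable_one_div_nat_pow.2 (by norm_num))
  rw [← tsum_pnat_one_div_cube]
  exact hs.tsum_pos (fun n => by positivity) 1 (by simp)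

/-! ### Sums over lattice points and over primitive lattice points -/

/-- Every nonzero lattice point of the quadrant is a unique positive multiple of a primitive one. -/
lemma bijective_smul_primitive :
    Function.Bijective (fun p : ℕ+ × Xc =>
      (⟨((p.1 : ℕ) * p.2.1.1, (p.1 : ℕ) * p.2.1.2), by
        rintro h
        obtain ⟨d, ⟨a, b⟩, hab⟩ := p
        simp only [Prod.mk_eq_zero, mul_eq_zero, PNat.ne_zero, false_or] at h
        simp [h.1, h.2] at hab⟩ : {v : ℕ × ℕ // v ≠ 0})) := by
  have hgcd : ∀ p : ℕ+ × Xc, Nat.gcd ((p.1 : ℕ) * p.2.1.1) ((p.1 : ℕ) * p.2.1.2) = p.1 := by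
    intro p
    rw [Nat.gcd_mul_left, p.2.2, mul_one]
  constructor
  · intro p p' h
    simp only [Subtype.mk.injEq, Prod.mk.injEq] at h
    have hd : p.1 = p'.1 := PNat.coe_injective (by rw [← hgcd p, ← hgcd p', h.1, h.2])
    rw [← hd] at h
    refine Prod.ext hd (Subtype.ext (Prod.ext ?_ ?_))
    · exact Nat.eq_of_mul_eq_mul_left p.1.pos h.1
    · exact Nat.eq_of_mul_eq_mul_left p.1.pos h.2
  · rintro ⟨⟨a, b⟩, hab⟩
    have hpos : 0 < Nat.gcd a b := by
      refine Nat.pos_of_ne_zero fun h => hab ?_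
      rw [Nat.gcd_eq_zero_iff] at h
      simp [h.1, h.2]
    refine ⟨(⟨Nat.gcd a b, hpos⟩, ⟨(a / Nat.gcd a b, b / Nat.gcd a b),
      Nat.coprime_div_gcd_div_gcd hpos⟩), ?_⟩
    simp [Nat.mul_div_cancel' (Nat.gcd_dvd_left a b), Nat.mul_div_cancel' (Nat.gcd_dvd_right a b)]

/-- The sum of `exp (-(s * a + t * b))` over the nonzero `(a, b) : ℕ × ℕ`. -/
noncomputable def latticeSum (s t : ℝ) : ℝ :=
  1 / (Real.exp s - 1) * (1 / (Real.exp t - 1)) + 1 / (Real.exp s - 1) + 1 / (Real.exp t - 1)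

/-- The sum of `exp (-(s * a + t * b))` over the primitive `(a, b) : ℕ × ℕ`. -/
noncomputable def primitiveSum (s t : ℝ) : ℝ :=
  ∑' x : Xc, Real.exp (-(s * x.1.1 + t * x.1.2))

lemma hasSum_exp_neg_mul {s : ℝ} (hs : 0 < s) :
    HasSum (fun a : ℕ => Real.exp (-(s * a))) (1 / (Real.exp s - 1) + 1) := by
  have h := hasSum_geometric_of_lt_one (Real.exp_pos (-s)).le (Real.exp_zero ▸ Real.exp_lt_exp.2 (by linarith))
  have h1 : Real.exp s - 1 ≠ 0 := by have := Real.add_one_lt_exp hs.ne'; linarith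
  have h2 : (1 - Real.exp (-s))⁻¹ = 1 / (Real.exp s - 1) + 1 := by
    rw [Real.exp_neg]
    have h3 : 1 - (Real.exp s)⁻¹ ≠ 0 := by
      have := Real.exp_pos s
      field_simp
      exact div_ne_zero h1 this.ne'
    have := (Real.exp_pos s).ne'
    field_simp
    ring
  rw [h2] at h
  refine h.congr_fun fun a => ?_
  rw [← Real.exp_nat_mul]
  congr 1
  ring

lemma hasSum_exp_neg_quadrant {s t : ℝ} (hs : 0 < s) (ht : 0 < t) :
    HasSum (fun v : {v : ℕ × ℕ // v ≠ 0} => Real.exp (-(s * v.1.1 + t * v.1.2)))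
      (latticeSum s t) := by
  have h := (hasSum_exp_neg_mul hs).mul (hasSum_exp_neg_mul ht)
    ((hasSum_exp_neg_mul hs).summable.mul_of_nonneg (hasSum_exp_neg_mul ht).summable
      (fun _ => (Real.exp_pos _).le) (fun _ => (Real.exp_pos _).le))
  have h' : HasSum (fun v : ℕ × ℕ => Real.exp (-(s * v.1 + t * v.2)))
      ((1 / (Real.exp s - 1) + 1) * (1 / (Real.exp t - 1) + 1)) := by
    refine h.congr_fun fun v => ?_
    rw [← Real.exp_add]
    congr 1
    ring
  have e : (1 / (Real.exp s - 1) + 1) * (1 / (Real.exp t - 1) + 1) = latticeSum s t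
      + ∑ v ∈ ({0} : Finset (ℕ × ℕ)), Real.exp (-(s * v.1 + t * v.2)) := by
    rw [Finset.sum_singleton]
    simp only [latticeSum, Prod.fst_zero, Prod.snd_zero, Nat.cast_zero, mul_zero, add_zero,
      neg_zero, Real.exp_zero]
    ring
  have hc := (Finset.hasSum_compl_iff {0}).2 (e ▸ h')
  exact (Equiv.subtypeEquivRight (p := fun v : ℕ × ℕ => v ≠ 0)
    (q := fun v : ℕ × ℕ => v ∉ ({0} : Finset (ℕ × ℕ))) (fun v => by simp)).hasSum_iff.2 hc

lemma hasSum_exp_neg_smul_primitive {s t : ℝ} (hs : 0 < s) (ht : 0 < t) :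
    HasSum (fun p : ℕ+ × Xc => Real.exp (-((p.1 : ℝ) * s * p.2.1.1 + (p.1 : ℝ) * t * p.2.1.2)))
      (latticeSum s t) := by
  have h := (Equiv.ofBijective _ bijective_smul_primitive).hasSum_iff.2
    (hasSum_exp_neg_quadrant hs ht)
  refine h.congr_fun fun p => ?_
  simp only [Function.comp, Equiv.ofBijective_apply]
  push_cast
  congr 1
  ring

lemma summable_exp_neg_primitive {s t : ℝ} (hs : 0 < s) (ht : 0 < t) :
    Summable fun x : Xc => Real.exp (-(s * x.1.1 + t * x.1.2)) := by
  simpa using (hasSum_exp_neg_smul_primitive hs ht).summable.prod_factor 1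

lemma hasSum_primitiveSum {s t : ℝ} (hs : 0 < s) (ht : 0 < t) :
    HasSum (fun d : ℕ+ => primitiveSum (d * s) (d * t)) (latticeSum s t) := by
  have hd : ∀ d : ℕ+, (0 : ℝ) < d := fun d => by exact_mod_cast d.pos
  exact (hasSum_exp_neg_smul_primitive hs ht).prod_fiberwise fun d =>
    (summable_exp_neg_primitive (mul_pos (hd d) hs) (mul_pos (hd d) ht)).hasSum

lemma primitiveSum_nonneg (s t : ℝ) : 0 ≤ primitiveSum s t :=
  tsum_nonneg fun _ => (Real.exp_pos _).le

lemma primitiveSum_le_latticeSum {s t : ℝ} (hs : 0 < s) (ht : 0 < t) :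
    primitiveSum s t ≤ latticeSum s t := by
  simpa using le_hasSum (hasSum_primitiveSum hs ht) 1 fun d _ => primitiveSum_nonneg _ _

lemma latticeSum_nonneg {s t : ℝ} (hs : 0 < s) (ht : 0 < t) : 0 ≤ latticeSum s t :=
  (primitiveSum_nonneg s t).trans (primitiveSum_le_latticeSum hs ht)

lemma latticeSum_le {s t : ℝ} (hs : 0 < s) (ht : 0 < t) :
    latticeSum s t ≤ 1 / (s * t) + 2 / s ^ 2 + 2 / t ^ 2 := by
  have h1 : ∀ {u : ℝ}, 0 < u → 1 / (Real.exp u - 1) ≤ 1 / u := fun {u} hu =>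
    one_div_le_one_div_of_le hu (by linarith [Real.add_one_le_exp u])
  have h2 : ∀ {u : ℝ}, 0 < u → 1 / (Real.exp u - 1) ≤ 2 / u ^ 2 := fun {u} hu => by
    have := Real.quadratic_le_exp_of_nonneg hu.le
    rw [div_le_div_iff₀ (by nlinarith) (by positivity)]
    nlinarith
  have h0 : ∀ {u : ℝ}, 0 < u → 0 ≤ 1 / (Real.exp u - 1) := fun {u} hu =>
    one_div_nonneg.2 (by linarith [Real.add_one_le_exp u])
  have h3 := mul_le_mul (h1 hs) (h1 ht) (h0 ht) (by positivity)
  have h4 : 1 / s * (1 / t) = 1 / (s * t) := by field_simp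
  unfold latticeSum
  linarith [h2 hs, h2 ht]

lemma latticeSum_mul_le {s t d : ℝ} (hs : 0 < s) (ht : 0 < t) (hd : 0 < d) :
    latticeSum (d * s) (d * t) ≤ (1 / (s * t) + 2 / s ^ 2 + 2 / t ^ 2) * (1 / d ^ 2) := by
  refine (latticeSum_le (mul_pos hd hs) (mul_pos hd ht)).trans (le_of_eq ?_)
  field_simp

lemma primitiveSum_eq_tsum_moebius {s t : ℝ} (hs : 0 < s) (ht : 0 < t) :
    primitiveSum s t = ∑' d : ℕ+,
      (ArithmeticFunction.moebius (d : ℕ) : ℝ) * latticeSum (d * s) (d * t) := by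
  have hd : ∀ d : ℕ+, (0 : ℝ) < d := fun d => by exact_mod_cast d.pos
  have h := tsum_moebius_mul_tsum (f := fun n : ℕ => primitiveSum (n * s) (n * t)) (by
    refine Summable.of_nonneg_of_le (fun p => primitiveSum_nonneg _ _) (fun p => ?_)
      (summable_prod_one_div_sq.mul_left (1 / (s * t) + 2 / s ^ 2 + 2 / t ^ 2))
    have hp : (0 : ℝ) < ((p.1 : ℕ) * p.2 : ℕ) := by exact_mod_cast Nat.mul_pos p.1.pos p.2.pos
    refine (primitiveSum_le_latticeSum (mul_pos hp hs) (mul_pos hp ht)).trans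
      ((latticeSum_mul_le hs ht hp).trans (le_of_eq ?_))
    push_cast
    ring)
  rw [Nat.cast_one, one_mul, one_mul] at h
  rw [← h]
  refine tsum_congr fun d => ?_
  rw [← (hasSum_primitiveSum (mul_pos (hd d) hs) (mul_pos (hd d) ht)).tsum_eq]
  congr 1
  refine tsum_congr fun e => ?_
  push_cast
  congr 1 <;> ring

/-! ### Asymptotics at the origin -/

lemma tendsto_mul_one_div_exp_sub_one {a : ℝ} (ha : 0 < a) :
    Tendsto (fun r : ℝ => r * (1 / (Real.exp (a * r) - 1))) (nhdsWithin 0 (Set.Ioi 0))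
      (nhds (1 / a)) := by
  have h : HasDerivAt (fun r : ℝ => Real.exp (a * r)) a 0 := by
    simpa using ((hasDerivAt_id (0 : ℝ)).const_mul a).exp
  have h1 := (hasDerivAt_iff_tendsto_slope.1 h).mono_left
    (nhdsWithin_mono 0 (fun r (hr : 0 < r) => hr.ne'))
  have h2 := h1.inv₀ ha.ne'
  rw [one_div]
  refine h2.congr fun r => ?_
  simp [slope_def_field, div_eq_mul_inv, mul_comm]

lemma tendsto_sq_mul_latticeSum {a b : ℝ} (ha : 0 < a) (hb : 0 < b) :
    Tendsto (fun r : ℝ => r ^ 2 * latticeSum (a * r) (b * r)) (nhdsWithin 0 (Set.Ioi 0))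
      (nhds (1 / (a * b))) := by
  have hr : Tendsto (fun r : ℝ => r) (nhdsWithin 0 (Set.Ioi 0)) (nhds 0) :=
    tendsto_nhdsWithin_of_tendsto_nhds tendsto_id
  have hA := tendsto_mul_one_div_exp_sub_one ha
  have hB := tendsto_mul_one_div_exp_sub_one hb
  have h := ((hA.mul hB).add (hr.mul hA)).add (hr.mul hB)
  have e : 1 / a * (1 / b) + 0 * (1 / a) + 0 * (1 / b) = 1 / (a * b) := by field_simp; ring
  rw [e] at h
  refine h.congr fun r => ?_
  unfold latticeSum
  ring

lemma sq_mul_latticeSum_le {a b d r : ℝ} (ha : 0 < a) (hb : 0 < b) (hd : 0 < d) (hr : 0 < r) :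
    r ^ 2 * latticeSum (d * (a * r)) (d * (b * r))
      ≤ (1 / (a * b) + 2 / a ^ 2 + 2 / b ^ 2) * (1 / d ^ 2) := by
  refine (mul_le_mul_of_nonneg_left
    (latticeSum_mul_le (mul_pos ha hr) (mul_pos hb hr) hd) (by positivity)).trans (le_of_eq ?_)
  field_simp

lemma tendsto_sq_mul_primitiveSum {a b : ℝ} (ha : 0 < a) (hb : 0 < b) :
    Tendsto (fun r : ℝ => r ^ 2 * primitiveSum (a * r) (b * r)) (nhdsWithin 0 (Set.Ioi 0))
      (nhds (1 / (a * b) * (1 / zeta2))) := by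
  have hd : ∀ d : ℕ+, (0 : ℝ) < d := fun d => by exact_mod_cast d.pos
  have h := tendsto_tsum_of_dominated_convergence (𝓕 := nhdsWithin (0 : ℝ) (Set.Ioi 0))
    (f := fun r (d : ℕ+) => (ArithmeticFunction.moebius (d : ℕ) : ℝ) *
      (r ^ 2 * latticeSum (d * (a * r)) (d * (b * r))))
    (g := fun d : ℕ+ => (ArithmeticFunction.moebius (d : ℕ) : ℝ) *
      (1 / ((d * a) * (d * b))))
    (summable_pnat_one_div_sq.mul_left (1 / (a * b) + 2 / a ^ 2 + 2 / b ^ 2))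
    (fun d => by
      refine Tendsto.const_mul _ ?_
      refine (tendsto_sq_mul_latticeSum (mul_pos (hd d) ha) (mul_pos (hd d) hb)).congr fun r => ?_
      rw [mul_assoc, mul_assoc])
    (by
      filter_upwards [self_mem_nhdsWithin] with r hr d
      have hr : 0 < r := hr
      have hμ : |(ArithmeticFunction.moebius (d : ℕ) : ℝ)| ≤ 1 := by
        exact_mod_cast ArithmeticFunction.abs_moebius_le_one
      have hnn := latticeSum_nonneg (mul_pos (hd d) (mul_pos ha hr))
        (mul_pos (hd d) (mul_pos hb hr))
      have hnn' : 0 ≤ r ^ 2 * latticeSum (d * (a * r)) (d * (b * r)) := by positivity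
      rw [Real.norm_eq_abs, abs_mul, abs_of_nonneg hnn']
      exact (mul_le_of_le_one_left hnn' hμ).trans (sq_mul_latticeSum_le ha hb (hd d) hr))
  have e : ∑' d : ℕ+, (ArithmeticFunction.moebius (d : ℕ) : ℝ) * (1 / ((d * a) * (d * b)))
      = 1 / (a * b) * (1 / zeta2) := by
    rw [← tsum_moebius_div_sq, ← tsum_mul_left]
    refine tsum_congr fun d => ?_
    have := (hd d).ne'
    field_simp
  rw [e] at h
  refine h.congr' ?_
  filter_upwards [self_mem_nhdsWithin] with r hr
  have hr : 0 < r := hr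
  rw [primitiveSum_eq_tsum_moebius (mul_pos ha hr) (mul_pos hb hr), ← tsum_mul_left]
  exact tsum_congr fun d => by ring

/-- The logarithm of the partition function of the Boltzmann ensemble of convex chains. -/
noncomputable def logPartition (s t : ℝ) : ℝ :=
  ∑' x : Xc, -Real.log (1 - Real.exp (-(s * x.1.1 + t * x.1.2)))

lemma primitive_form_pos {s t : ℝ} (hs : 0 < s) (ht : 0 < t) (x : Xc) :
    0 < s * x.1.1 + t * x.1.2 := by
  obtain ⟨⟨a, b⟩, hab⟩ := x
  rcases Nat.eq_zero_or_pos a with rfl | ha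
  · have : b = 1 := by simpa using hab
    simp [this, ht]
  · have : (0 : ℝ) < a := by exact_mod_cast ha
    simp only
    positivity

lemma hasSum_neg_log_one_sub_exp {u : ℝ} (hu : 0 < u) :
    HasSum (fun k : ℕ+ => 1 / (k : ℝ) * Real.exp (-(k * u))) (-Real.log (1 - Real.exp (-u))) := by
  have h := Real.hasSum_pow_div_log_of_abs_lt_one (x := Real.exp (-u))
    (by rw [abs_of_pos (Real.exp_pos _)]; exact Real.exp_zero ▸ Real.exp_lt_exp.2 (by linarith))
  refine (hasSum_pnat_iff_hasSum_succ
    (f := fun k : ℕ => 1 / (k : ℝ) * Real.exp (-(k * u)))).2 (h.congr_fun fun n => ?_)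
  rw [← Real.exp_nat_mul, mul_neg]
  push_cast
  rw [one_div, div_eq_inv_mul]

lemma summable_exp_neg_div {s t : ℝ} (hs : 0 < s) (ht : 0 < t) :
    Summable fun p : Xc × ℕ+ => 1 / (p.2 : ℝ) * Real.exp (-(p.2 * (s * p.1.1.1 + t * p.1.1.2))) := by
  have h := (hasSum_exp_neg_smul_primitive hs ht).summable.prod_symm
  refine Summable.of_nonneg_of_le (fun p => by positivity) (fun p => ?_) h
  have hk : (1 : ℝ) ≤ p.2 := by exact_mod_cast one_le (a := p.2)
  have e : -((p.2 : ℝ) * (s * p.1.1.1 + t * p.1.1.2))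
    = -((p.2 : ℝ) * s * p.1.1.1 + (p.2 : ℝ) * t * p.1.1.2) := by ring
  rw [e]
  exact mul_le_of_le_one_left (Real.exp_pos _).le ((div_le_one (by linarith)).2 hk)

lemma summable_neg_log_one_sub_exp {s t : ℝ} (hs : 0 < s) (ht : 0 < t) :
    Summable fun x : Xc => -Real.log (1 - Real.exp (-(s * x.1.1 + t * x.1.2))) :=
  (summable_exp_neg_div hs ht).prod.congr fun x =>
    ((hasSum_neg_log_one_sub_exp (primitive_form_pos hs ht x)).tsum_eq)

lemma logPartition_eq_tsum {s t : ℝ} (hs : 0 < s) (ht : 0 < t) :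
    logPartition s t = ∑' k : ℕ+, 1 / (k : ℝ) * primitiveSum (k * s) (k * t) := by
  have h := (summable_exp_neg_div hs ht).tsum_comm
    (f := fun (x : Xc) (k : ℕ+) => 1 / (k : ℝ) * Real.exp (-(k * (s * x.1.1 + t * x.1.2))))
  rw [logPartition, tsum_congr fun x =>
    ((hasSum_neg_log_one_sub_exp (primitive_form_pos hs ht x)).tsum_eq).symm, ← h]
  refine tsum_congr fun k => ?_
  rw [tsum_mul_left, primitiveSum]
  congr 1
  refine tsum_congr fun x => ?_
  congr 1
  ring

lemma tendsto_sq_mul_logPartition {a b : ℝ} (ha : 0 < a) (hb : 0 < b) :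
    Tendsto (fun r : ℝ => r ^ 2 * logPartition (a * r) (b * r)) (nhdsWithin 0 (Set.Ioi 0))
      (nhds (zeta3 / zeta2 / (a * b))) := by
  have hd : ∀ d : ℕ+, (0 : ℝ) < d := fun d => by exact_mod_cast d.pos
  have h := tendsto_tsum_of_dominated_convergence (𝓕 := nhdsWithin (0 : ℝ) (Set.Ioi 0))
    (f := fun r (k : ℕ+) => 1 / (k : ℝ) * (r ^ 2 * primitiveSum (k * (a * r)) (k * (b * r))))
    (g := fun k : ℕ+ => 1 / (k : ℝ) * (1 / ((k * a) * (k * b)) * (1 / zeta2)))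
    (summable_pnat_one_div_sq.mul_left (1 / (a * b) + 2 / a ^ 2 + 2 / b ^ 2))
    (fun k => by
      refine Tendsto.const_mul _ ?_
      refine (tendsto_sq_mul_primitiveSum (mul_pos (hd k) ha) (mul_pos (hd k) hb)).congr
        fun r => ?_
      rw [mul_assoc, mul_assoc])
    (by
      filter_upwards [self_mem_nhdsWithin] with r hr k
      have hr : 0 < r := hr
      have hk : (1 : ℝ) ≤ k := by exact_mod_cast one_le (a := k)
      have hnn' : 0 ≤ r ^ 2 * primitiveSum (k * (a * r)) (k * (b * r)) :=
        mul_nonneg (by positivity) (primitiveSum_nonneg _ _)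
      rw [Real.norm_eq_abs, abs_of_nonneg (mul_nonneg (by positivity) hnn')]
      refine (mul_le_of_le_one_left hnn' ((div_le_one (hd k)).2 hk)).trans ?_
      refine le_trans ?_ (sq_mul_latticeSum_le ha hb (hd k) hr)
      exact mul_le_mul_of_nonneg_left (primitiveSum_le_latticeSum
        (mul_pos (hd k) (mul_pos ha hr)) (mul_pos (hd k) (mul_pos hb hr))) (by positivity))
  have e : ∑' k : ℕ+, 1 / (k : ℝ) * (1 / ((k * a) * (k * b)) * (1 / zeta2))
      = zeta3 / zeta2 / (a * b) := by
    have : zeta3 / zeta2 / (a * b) = 1 / zeta2 / (a * b) * zeta3 := by ring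
    rw [this, ← tsum_pnat_one_div_cube, ← tsum_mul_left]
    refine tsum_congr fun k => ?_
    have := (hd k).ne'
    have := zeta2_pos.ne'
    field_simp
  rw [e] at h
  refine h.congr' ?_
  filter_upwards [self_mem_nhdsWithin] with r hr
  have hr : 0 < r := hr
  rw [logPartition_eq_tsum (mul_pos ha hr) (mul_pos hb hr), ← tsum_mul_left]
  exact tsum_congr fun d => by ring

/-! ### Counting convex chains -/

lemma exp_neg_chainEndpoint (s t : ℝ) (ν : Xc →₀ ℕ) :
    Real.exp (-(s * (chainEndpoint ν).1 + t * (chainEndpoint ν).2))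
      = ν.prod fun x m => Real.exp (-(s * x.1.1 + t * x.1.2)) ^ m := by
  simp only [chainEndpoint, Finsupp.sum, Finsupp.prod]
  push_cast
  rw [Finset.mul_sum, Finset.mul_sum, ← Finset.sum_add_distrib, ← Finset.sum_neg_distrib,
    Real.exp_sum]
  refine Finset.prod_congr rfl fun x _ => ?_
  rw [← Real.exp_nat_mul]
  congr 1
  ring

lemma hasSum_exp_neg_chainEndpoint {s t : ℝ} (hs : 0 < s) (ht : 0 < t) :
    HasSum (fun ν : Xc →₀ ℕ =>
      Real.exp (-(s * (chainEndpoint ν).1 + t * (chainEndpoint ν).2)))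
      (Real.exp (logPartition s t)) := by
  simp_rw [exp_neg_chainEndpoint]
  exact hasSum_finsupp_prod_pow (fun x => (Real.exp_pos _).le)
    (fun x => Real.exp_zero ▸ Real.exp_lt_exp.2
      (neg_neg_of_pos (primitive_form_pos hs ht x)))
    (summable_neg_log_one_sub_exp hs ht)

lemma finite_chains_le (n : ℕ) :
    {ν : Xc →₀ ℕ | (chainEndpoint ν).1 ≤ n ∧ (chainEndpoint ν).2 ≤ n}.Finite := by
  have h := (hasSum_exp_neg_chainEndpoint one_pos one_pos).summable.tendsto_cofinite_zero
  have h' := h.eventually (gt_mem_nhds (Real.exp_pos (-(1 * (n : ℝ) + 1 * n))))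
  refine (Filter.eventually_cofinite.1 h').subset fun ν hν => ?_
  simp only [Set.mem_ofPred_eq, not_lt, Real.exp_le_exp] at hν ⊢
  have h1 : ((chainEndpoint ν).1 : ℝ) ≤ n := by exact_mod_cast hν.1
  have h2 : ((chainEndpoint ν).2 : ℝ) ≤ n := by exact_mod_cast hν.2
  linarith

instance finite_chains (n : ℕ) : Finite {ν : Xc →₀ ℕ // chainEndpoint ν = (n, n)} :=
  ((finite_chains_le n).subset fun ν (hν : chainEndpoint ν = (n, n)) => by simp [hν]).to_subtype

lemma chainEndpoint_add (ν ν' : Xc →₀ ℕ) :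
    chainEndpoint (ν + ν') = chainEndpoint ν + chainEndpoint ν' := by
  unfold chainEndpoint
  rw [Finsupp.sum_add_index' (by simp) (by intros; ring),
    Finsupp.sum_add_index' (by simp) (by intros; ring)]
  rfl

lemma chainEndpoint_single (x : Xc) (m : ℕ) :
    chainEndpoint (Finsupp.single x m) = (m * x.1.1, m * x.1.2) := by
  simp [chainEndpoint]

/-- Completing a chain in the square by axis-parallel segments reaches its corner. -/
lemma ncard_chains_le (n : ℕ) :
    {ν : Xc →₀ ℕ | (chainEndpoint ν).1 ≤ n ∧ (chainEndpoint ν).2 ≤ n}.ncard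
      ≤ (n + 1) ^ 2 * Nat.card {ν : Xc →₀ ℕ // chainEndpoint ν = (n, n)} := by
  have hcard : (n + 1) ^ 2 * Nat.card {ν : Xc →₀ ℕ // chainEndpoint ν = (n, n)}
      = Nat.card ((Fin (n + 1) × Fin (n + 1)) × {ν : Xc →₀ ℕ // chainEndpoint ν = (n, n)}) := by
    simp [Nat.card_prod, sq]
  rw [hcard, ← Nat.card_coe_set_eq]
  let pad : (Xc →₀ ℕ) → (Xc →₀ ℕ) := fun ν =>
    Finsupp.single ⟨(1, 0), by simp⟩ (n - (chainEndpoint ν).1)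
      + Finsupp.single ⟨(0, 1), by simp⟩ (n - (chainEndpoint ν).2)
  refine Nat.card_le_card_of_injective (fun ν :
      {ν : Xc →₀ ℕ | (chainEndpoint ν).1 ≤ n ∧ (chainEndpoint ν).2 ≤ n} =>
    ((⟨(chainEndpoint ν.1).1, Nat.lt_succ_of_le ν.2.1⟩,
      ⟨(chainEndpoint ν.1).2, Nat.lt_succ_of_le ν.2.2⟩),
      ⟨ν.1 + pad ν.1, by
        have h1 := ν.2.1
        have h2 := ν.2.2
        rw [chainEndpoint_add, chainEndpoint_add, chainEndpoint_single, chainEndpoint_single]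
        ext
        · simp only [Prod.fst_add]; omega
        · simp only [Prod.snd_add]; omega⟩)) ?_
  intro ν ν' h
  simp only [Prod.mk.injEq, Fin.mk.injEq, Subtype.mk.injEq] at h
  obtain ⟨⟨h1, h2⟩, h3⟩ := h
  have hpad : pad ν.1 = pad ν'.1 := by simp only [pad, h1, h2]
  rw [hpad] at h3
  exact Subtype.ext (add_right_cancel h3)

lemma card_chains_pos (n : ℕ) : 0 < Nat.card {ν : Xc →₀ ℕ // chainEndpoint ν = (n, n)} := by
  have h := ncard_chains_le n
  have h0 : 0 < {ν : Xc →₀ ℕ | (chainEndpoint ν).1 ≤ n ∧ (chainEndpoint ν).2 ≤ n}.ncard :=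
    (Set.ncard_pos (finite_chains_le n)).2 ⟨0, by simp [chainEndpoint]⟩
  exact Nat.pos_of_mul_pos_left (h0.trans_le h)

lemma log_card_chains_le (n : ℕ) {s : ℝ} (hs : 0 < s) :
    Real.log (Nat.card {ν : Xc →₀ ℕ // chainEndpoint ν = (n, n)})
      ≤ logPartition s s + 2 * (s * n) := by
  have hsum := hasSum_exp_neg_chainEndpoint hs hs
  have h := Summable.tsum_subtype_le _ {ν : Xc →₀ ℕ | chainEndpoint ν = (n, n)}
    (fun ν => (Real.exp_pos _).le) hsum.summable
  have e : ∑' ν : {ν : Xc →₀ ℕ | chainEndpoint ν = (n, n)},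
      Real.exp (-(s * (chainEndpoint ν.1).1 + s * (chainEndpoint ν.1).2))
      = Nat.card {ν : Xc →₀ ℕ // chainEndpoint ν = (n, n)} * Real.exp (-(2 * (s * n))) := by
    rw [tsum_congr (g := fun _ => Real.exp (-(2 * (s * n)))) (fun ν => by
      have hν : chainEndpoint ν.1 = (n, n) := ν.2
      rw [hν]
      congr 1
      ring), tsum_const, nsmul_eq_mul]
    rfl
  rw [hsum.tsum_eq, e, Real.exp_neg, ← div_eq_mul_inv, div_le_iff₀ (Real.exp_pos _),
    ← Real.exp_add] at h
  exact (Real.log_le_iff_le_exp (by exact_mod_cast card_chains_pos n)).2 h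

/-- Chernoff's bound: the partition function is controlled by the chains whose endpoint lies in
the square and is not too close to the origin, up to tilted partition functions. -/
lemma exp_logPartition_le (n : ℕ) {s δ θ : ℝ} (hs : 0 < s) (hδ : 0 < δ) (hδ1 : δ < 1) :
    Real.exp (logPartition s s)
      ≤ (n + 1) ^ 2 * Nat.card {ν : Xc →₀ ℕ // chainEndpoint ν = (n, n)}
          * Real.exp (-(2 * (s * (θ * n))))
        + Real.exp (-(δ * s * n)) * Real.exp (logPartition ((1 - δ) * s) s)
        + Real.exp (-(δ * s * n)) * Real.exp (logPartition s ((1 - δ) * s))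
        + Real.exp (2 * δ * s * (θ * n))
          * Real.exp (logPartition ((1 + δ) * s) ((1 + δ) * s)) := by
  set A : Set (Xc →₀ ℕ) := {ν | (chainEndpoint ν).1 ≤ n ∧ (chainEndpoint ν).2 ≤ n}
  have hfin : A.Finite := finite_chains_le n
  have hs1 : 0 < (1 - δ) * s := mul_pos (by linarith) hs
  have hs2 : 0 < (1 + δ) * s := mul_pos (by linarith) hs
  have hZ := hasSum_exp_neg_chainEndpoint hs hs
  have hZ1 := (hasSum_exp_neg_chainEndpoint hs1 hs).mul_left (Real.exp (-(δ * s * n)))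
  have hZ2 := (hasSum_exp_neg_chainEndpoint hs hs1).mul_left (Real.exp (-(δ * s * n)))
  have hZ3 := (hasSum_exp_neg_chainEndpoint hs2 hs2).mul_left (Real.exp (2 * δ * s * (θ * n)))
  have hgood : HasSum (A.indicator fun _ => Real.exp (-(2 * (s * (θ * n)))))
      (A.ncard * Real.exp (-(2 * (s * (θ * n))))) := by
    have h := hasSum_sum_of_ne_finset_zero (L := .unconditional _) (f := A.indicator fun _ =>
      Real.exp (-(2 * (s * (θ * n))))) (s := hfin.toFinset) (fun ν hν => by
        rw [Set.indicator_of_notMem]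
        simpa using hν)
    have e : ∑ ν ∈ hfin.toFinset, A.indicator (fun _ => Real.exp (-(2 * (s * (θ * n))))) ν
        = A.ncard * Real.exp (-(2 * (s * (θ * n)))) := by
      rw [Finset.sum_congr rfl fun ν hν => Set.indicator_of_mem (hfin.mem_toFinset.1 hν) _,
        Finset.sum_const, nsmul_eq_mul, ← Set.ncard_eq_toFinset_card A hfin]
    rwa [e] at h
  have hle := hasSum_le (fun ν => ?_) hZ (((hgood.add hZ1).add hZ2).add hZ3)
  · refine hle.trans ?_
    gcongr
    exact_mod_cast ncard_chains_le n
  simp only [← Real.exp_add]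
  set a : ℝ := ((chainEndpoint ν).1 : ℝ)
  set b : ℝ := ((chainEndpoint ν).2 : ℝ)
  have hI : 0 ≤ A.indicator (fun _ => Real.exp (-(2 * (s * (θ * n))))) ν :=
    Set.indicator_nonneg (fun _ _ => (Real.exp_pos _).le) ν
  have p1 := Real.exp_pos (-(δ * s * n) + -((1 - δ) * s * a + s * b))
  have p2 := Real.exp_pos (-(δ * s * n) + -(s * a + (1 - δ) * s * b))
  have p3 := Real.exp_pos (2 * δ * s * (θ * n) + -((1 + δ) * s * a + (1 + δ) * s * b))
  have hδs : 0 < δ * s := mul_pos hδ hs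
  by_cases h1 : (n : ℝ) < a
  · have : Real.exp (-(s * a + s * b)) ≤ Real.exp (-(δ * s * n) + -((1 - δ) * s * a + s * b)) :=
      Real.exp_le_exp.2 (by nlinarith)
    linarith
  by_cases h2 : (n : ℝ) < b
  · have : Real.exp (-(s * a + s * b)) ≤ Real.exp (-(δ * s * n) + -(s * a + (1 - δ) * s * b)) :=
      Real.exp_le_exp.2 (by nlinarith)
    linarith
  by_cases h3 : a + b < 2 * (θ * n)
  · have : Real.exp (-(s * a + s * b))
        ≤ Real.exp (2 * δ * s * (θ * n) + -((1 + δ) * s * a + (1 + δ) * s * b)) :=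
      Real.exp_le_exp.2 (by nlinarith)
    linarith
  have hmem : ν ∈ A := ⟨Nat.cast_le.1 (not_lt.1 h1), Nat.cast_le.1 (not_lt.1 h2)⟩
  have : Real.exp (-(s * a + s * b)) ≤ A.indicator (fun _ => Real.exp (-(2 * (s * (θ * n))))) ν := by
    rw [Set.indicator_of_mem hmem]
    exact Real.exp_le_exp.2 (by nlinarith)
  linarith

/-! ### Scaling -/

/-- The inverse cube root of `n`, the scale of the parameter of the Boltzmann ensemble. -/
noncomputable def scale (n : ℕ) : ℝ := (n : ℝ) ^ (-(1 / 3) : ℝ)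

lemma scale_pos {n : ℕ} (hn : 0 < n) : 0 < scale n :=
  Real.rpow_pos_of_pos (by exact_mod_cast hn) _

lemma scale_cube_mul {n : ℕ} (hn : 0 < n) : scale n ^ 3 * n = 1 := by
  have h : (0 : ℝ) < n := by exact_mod_cast hn
  rw [scale, ← Real.rpow_natCast, ← Real.rpow_mul h.le]
  norm_num
  rw [Real.rpow_neg_one, inv_mul_cancel₀ h.ne']

lemma scale_sq_mul_rpow {n : ℕ} (hn : 0 < n) : scale n ^ 2 * (n : ℝ) ^ ((2 : ℝ) / 3) = 1 := by
  have h : (0 : ℝ) < n := by exact_mod_cast hn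
  rw [scale, ← Real.rpow_natCast, ← Real.rpow_mul h.le, ← Real.rpow_add h]
  norm_num

lemma tendsto_scale : Tendsto scale atTop (nhds 0) :=
  (tendsto_rpow_neg_atTop (by norm_num : (0 : ℝ) < 1 / 3)).comp tendsto_natCast_atTop_atTop

lemma tendsto_scale_nhdsWithin : Tendsto scale atTop (nhdsWithin 0 (Set.Ioi 0)) :=
  tendsto_nhdsWithin_iff.2
    ⟨tendsto_scale, (eventually_gt_atTop 0).mono fun _ hn => scale_pos hn⟩

lemma tendsto_scale_sq_mul_logPartition {a b : ℝ} (ha : 0 < a) (hb : 0 < b) :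
    Tendsto (fun n => scale n ^ 2 * logPartition (a * scale n) (b * scale n)) atTop
      (nhds (zeta3 / zeta2 / (a * b))) :=
  (tendsto_sq_mul_logPartition ha hb).comp tendsto_scale_nhdsWithin

lemma tendsto_scale_sq_mul_mul (a : ℝ) :
    Tendsto (fun n : ℕ => scale n ^ 2 * (a * scale n * n)) atTop (nhds a) := by
  refine tendsto_const_nhds.congr' ((eventually_gt_atTop 0).mono fun n hn => ?_)
  linear_combination (-a) * scale_cube_mul hn

lemma tendsto_scale_sq_mul_log :
    Tendsto (fun n : ℕ => scale n ^ 2 * (Real.log 2 + 2 * Real.log (n + 1))) atTop (nhds 0) := by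
  have h : (fun x : ℝ => Real.log x) =o[atTop] fun x => x ^ ((2 : ℝ) / 3) :=
    isLittleO_log_rpow_atTop (by norm_num)
  have h1 := h.tendsto_div_nhds_zero.comp tendsto_natCast_atTop_atTop
  have hub : Tendsto (fun n : ℕ => scale n ^ 2 * (3 * Real.log 2)
      + 2 * (Real.log n / (n : ℝ) ^ ((2 : ℝ) / 3))) atTop (nhds 0) := by
    simpa using ((tendsto_scale.pow 2).mul_const (3 * Real.log 2)).add (h1.const_mul 2)
  refine squeeze_zero' (Eventually.of_forall fun n => ?_) ?_ hub
  · have := Real.log_nonneg (x := (n : ℝ) + 1) (by simp)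
    positivity
  · filter_upwards [eventually_gt_atTop 0] with n hn
    have hn1 : (1 : ℝ) ≤ n := by exact_mod_cast hn
    have hlog : Real.log ((n : ℝ) + 1) ≤ Real.log 2 + Real.log n := by
      rw [← Real.log_mul (by norm_num) (by linarith)]
      exact Real.log_le_log (by linarith) (by linarith)
    have e : Real.log n / (n : ℝ) ^ ((2 : ℝ) / 3) = scale n ^ 2 * Real.log n := by
      rw [div_eq_iff (by positivity)]
      linear_combination (-Real.log n) * scale_sq_mul_rpow hn
    rw [e]
    nlinarith [mul_le_mul_of_nonneg_left hlog (sq_nonneg (scale n))]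

lemma tendsto_exp_of_scale {E : ℕ → ℝ} {l : ℝ} (hl : l < 0)
    (h : Tendsto (fun n => scale n ^ 2 * E n) atTop (nhds l)) :
    Tendsto (fun n => Real.exp (E n)) atTop (nhds 0) := by
  have hsq : Tendsto (fun n => scale n ^ 2) atTop (nhdsWithin 0 (Set.Ioi 0)) :=
    tendsto_nhdsWithin_iff.2 ⟨by simpa using tendsto_scale.pow 2,
      (eventually_gt_atTop 0).mono fun n hn => pow_pos (scale_pos hn) 2⟩
  have h1 := h.neg_mul_atTop hl hsq.inv_tendsto_nhdsGT_zero
  refine Real.tendsto_exp_atBot.comp (h1.congr' ((eventually_gt_atTop 0).mono fun n hn => ?_))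
  have := (scale_pos hn).ne'
  simp only [Pi.inv_apply]
  field_simp

lemma eventually_lt_scale_sq_mul_log_card {κ δ θ : ℝ} (hκ : 0 < κ) (hδ : 0 < δ) (hδ1 : δ < 1)
    (h1 : zeta3 / zeta2 / ((1 - δ) * κ * κ) - zeta3 / zeta2 / (κ * κ) - δ * κ < 0)
    (h3 : zeta3 / zeta2 / ((1 + δ) * κ * ((1 + δ) * κ)) - zeta3 / zeta2 / (κ * κ)
      + 2 * δ * κ * θ < 0)
    {a : ℝ} (ha : a < zeta3 / zeta2 / (κ * κ) + 2 * κ * θ) :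
    ∀ᶠ n : ℕ in atTop, a <
      scale n ^ 2 * Real.log (Nat.card {ν : Xc →₀ ℕ // chainEndpoint ν = (n, n)}) := by
  have hm : 0 < (1 - δ) * κ := mul_pos (by linarith) hκ
  have hp : 0 < (1 + δ) * κ := mul_pos (by linarith) hκ
  have t0 := tendsto_scale_sq_mul_logPartition hκ hκ
  have t1 := ((tendsto_scale_sq_mul_logPartition hm hκ).sub t0).sub
    (tendsto_scale_sq_mul_mul (δ * κ))
  have t2 := ((tendsto_scale_sq_mul_logPartition hκ hm).sub t0).sub
    (tendsto_scale_sq_mul_mul (δ * κ))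
  have t3 := ((tendsto_scale_sq_mul_logPartition hp hp).sub t0).add
    (tendsto_scale_sq_mul_mul (2 * δ * κ * θ))
  have e1 := tendsto_exp_of_scale (E := fun n : ℕ => -(δ * (κ * scale n) * n)
    + logPartition ((1 - δ) * (κ * scale n)) (κ * scale n)
    - logPartition (κ * scale n) (κ * scale n)) h1 (t1.congr fun n => by
      rw [mul_assoc (1 - δ)]; ring)
  have e2 := tendsto_exp_of_scale (E := fun n : ℕ => -(δ * (κ * scale n) * n)
    + logPartition (κ * scale n) ((1 - δ) * (κ * scale n))
    - logPartition (κ * scale n) (κ * scale n)) (by rw [mul_comm κ]; exact h1) (t2.congr fun n => by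
      rw [mul_assoc (1 - δ)]; ring)
  have e3 := tendsto_exp_of_scale (E := fun n : ℕ => 2 * δ * (κ * scale n) * (θ * n)
    + logPartition ((1 + δ) * (κ * scale n)) ((1 + δ) * (κ * scale n))
    - logPartition (κ * scale n) (κ * scale n)) h3 (t3.congr fun n => by
      rw [mul_assoc (1 + δ)]; ring)
  have t4 := (t0.add (tendsto_scale_sq_mul_mul (2 * κ * θ))).sub tendsto_scale_sq_mul_log
  rw [sub_zero] at t4
  have hsix : (0 : ℝ) < 1 / 6 := by norm_num
  filter_upwards [eventually_gt_atTop 0, e1.eventually (gt_mem_nhds hsix),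
    e2.eventually (gt_mem_nhds hsix), e3.eventually (gt_mem_nhds hsix),
    t4.eventually (lt_mem_nhds ha)] with n hn b1 b2 b3 b4
  have hs : 0 < κ * scale n := mul_pos hκ (scale_pos hn)
  have hmain := exp_logPartition_le n (θ := θ) hs hδ hδ1
  set s : ℝ := κ * scale n
  set P : ℝ := (Nat.card {ν : Xc →₀ ℕ // chainEndpoint ν = (n, n)} : ℝ)
  have hPpos : 0 < P := Nat.cast_pos.2 (card_chains_pos n)
  have hn1 : (0 : ℝ) < (n : ℝ) + 1 := by positivity
  rw [Real.exp_sub, div_lt_iff₀ (Real.exp_pos _)] at b1 b2 b3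
  simp only [← Real.exp_add, mul_assoc] at hmain b1 b2 b3
  have hhalf : Real.exp (logPartition s s)
      ≤ 2 * ((n + 1) ^ 2 * P) * Real.exp (-(2 * (s * (θ * n)))) := by
    linarith
  have hlog := (Real.log_le_log (Real.exp_pos _) hhalf)
  rw [Real.log_exp, Real.log_mul (by positivity) (Real.exp_pos _).ne', Real.log_exp,
    Real.log_mul two_ne_zero (by positivity), Real.log_mul (by positivity) hPpos.ne',
    Real.log_pow] at hlog
  have hfin : logPartition s s + 2 * κ * θ * scale n * n
      - (Real.log 2 + 2 * Real.log (n + 1)) ≤ Real.log P := by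
    have e : s = κ * scale n := rfl
    push_cast at hlog
    rw [e] at hlog ⊢
    linarith
  nlinarith [mul_le_mul_of_nonneg_left hfin (sq_nonneg (scale n))]

lemma tendsto_scale_sq_mul_log_card :
    Tendsto (fun n : ℕ => scale n ^ 2 *
        Real.log (Nat.card {ν : Xc →₀ ℕ // chainEndpoint ν = (n, n)})) atTop
      (nhds (3 * (zeta3 / zeta2) ^ ((1 : ℝ) / 3))) := by
  have hC : 0 < zeta3 / zeta2 := div_pos zeta3_pos zeta2_pos
  set c : ℝ := (zeta3 / zeta2) ^ ((1 : ℝ) / 3) with hc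
  have hcpos : 0 < c := Real.rpow_pos_of_pos hC _
  have hc3 : zeta3 / zeta2 = c ^ 3 := by
    rw [hc, ← Real.rpow_natCast, ← Real.rpow_mul hC.le]
    norm_num
  refine tendsto_order.2 ⟨fun a ha => ?_, fun b hb => ?_⟩
  · have hcont : Tendsto (fun η : ℝ => c / (1 + η) ^ 2 + 2 * c / (1 + η) ^ 3)
        (nhdsWithin 0 (Set.Ioi 0)) (nhds (3 * c)) := by
      have : ContinuousAt (fun η : ℝ => c / (1 + η) ^ 2 + 2 * c / (1 + η) ^ 3) 0 := by
        fun_prop (disch := norm_num)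
      have h := this.tendsto.mono_left (nhdsWithin_le_nhds (s := Set.Ioi 0))
      convert h using 2
      norm_num
      ring
    obtain ⟨η, haη, hη0, hη1⟩ := ((hcont.eventually (lt_mem_nhds ha)).and
      (Ioc_mem_nhdsGT (zero_lt_one' ℝ))).exists
    have hη : 0 < 1 + η := by linarith
    refine eventually_lt_scale_sq_mul_log_card (κ := c * (1 + η)) (δ := η / 4)
      (θ := 1 / (1 + η) ^ 4) (by positivity) (by positivity) (by linarith) ?_ ?_ ?_
    · rw [hc3]
      have hd : 0 < 1 - η / 4 := by linarith
      have hd' : 4 - η ≠ 0 := (by linarith : 0 < 4 - η).ne'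
      have e : c ^ 3 / ((1 - η / 4) * (c * (1 + η)) * (c * (1 + η)))
          - c ^ 3 / (c * (1 + η) * (c * (1 + η))) - η / 4 * (c * (1 + η))
          = -(c * (η / 4)) * ((1 + η) ^ 3 * (1 - η / 4) - 1) / ((1 - η / 4) * (1 + η) ^ 2) := by
        field_simp
        ring
      rw [e]
      refine div_neg_of_neg_of_pos (mul_neg_of_neg_of_pos (neg_neg_of_pos (by positivity)) ?_)
        (by positivity)
      nlinarith [pow_pos hη0 2, pow_pos hη0 3, mul_pos hη0 (pow_pos hη0 3),
        mul_nonneg (pow_pos hη0 3).le (sub_nonneg.2 hη1)]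
    · rw [hc3]
      have e : c ^ 3 / ((1 + η / 4) * (c * (1 + η)) * ((1 + η / 4) * (c * (1 + η))))
          - c ^ 3 / (c * (1 + η) * (c * (1 + η)))
          + 2 * (η / 4) * (c * (1 + η)) * (1 / (1 + η) ^ 4)
          = -(c * (η / 4)) * ((1 + η) * (2 + η / 4) - 2 * (1 + η / 4) ^ 2)
            / ((1 + η / 4) ^ 2 * (1 + η) ^ 3) := by
        field_simp
        ring
      rw [e]
      refine div_neg_of_neg_of_pos (mul_neg_of_neg_of_pos (neg_neg_of_pos (by positivity)) ?_)
        (by positivity)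
      nlinarith [pow_pos hη0 2]
    · rw [hc3]
      refine haη.trans_le (le_of_eq ?_)
      field_simp
  · have t := (tendsto_scale_sq_mul_logPartition hcpos hcpos).add
      (tendsto_scale_sq_mul_mul (2 * c))
    have e : zeta3 / zeta2 / (c * c) + 2 * c = 3 * c := by
      rw [hc3]
      field_simp
      ring
    rw [e] at t
    filter_upwards [eventually_gt_atTop 0, t.eventually (gt_mem_nhds hb)] with n hn hlt
    refine lt_of_le_of_lt ?_ hlt
    have h := mul_le_mul_of_nonneg_left (log_card_chains_le n (mul_pos hcpos (scale_pos hn)))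
      (sq_nonneg (scale n))
    linarith

/-- `ln(card Π_n) = 3·(ζ(3)/ζ(2))^{1/3}·n^{2/3}·(1 + o(1))` as `n → ∞`. -/
theorem statement2 :
    (fun n : ℕ => Real.log (Nat.card {ν : Xc →₀ ℕ // chainEndpoint ν = (n, n)}))
      ~[atTop] (fun n : ℕ => 3 * (zeta3 / zeta2) ^ ((1:ℝ)/3) * (n : ℝ) ^ ((2:ℝ)/3)) := by
  have hC : 0 < zeta3 / zeta2 := div_pos zeta3_pos zeta2_pos
  have hc : 3 * (zeta3 / zeta2) ^ ((1 : ℝ) / 3) ≠ 0 := by positivity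
  refine isEquivalent_of_tendsto_one ?_
  have h := tendsto_scale_sq_mul_log_card.div_const (3 * (zeta3 / zeta2) ^ ((1 : ℝ) / 3))
  rw [div_self hc] at h
  refine h.congr' ((eventually_gt_atTop 0).mono fun n hn => ?_)
  have hn' : (n : ℝ) ^ ((2 : ℝ) / 3) ≠ 0 :=
    (Real.rpow_pos_of_pos (by exact_mod_cast hn) _).ne'
  simp only [Pi.div_apply]
  rw [div_eq_div_iff hc (mul_ne_zero hc hn')]
  linear_combination (Real.log (Nat.card {ν : Xc →₀ ℕ // chainEndpoint ν = (n, n)})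
    * (3 * (zeta3 / zeta2) ^ ((1 : ℝ) / 3))) * scale_sq_mul_rpow hn
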